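/- Let $\nu > -1$ be a real number and define $b_0 = 0$ and $b_n = \dfrac{1}{(n-1)!\,\Gamma(\nu+n+2)\,4^{n}}$ for $n \ge 1$ (these are the Taylor coefficients of $\overline{Q}_\nu(z) = \sum_{k=0}^{\infty} \frac{1}{k!\,\Gamma(\nu+k+3)}(z/4)^{k+1}$). Then $\displaystyle \limsup_{n\to\infty} \, n^{2}\, |b_n|^{1/n} = \frac{e^{2}}{4}$; equivalently (since the order of $\overline{Q}_\nu$ is $\rho = 1/2$ and $(e\rho\sigma)^{1/\rho} = \limsup_n n^{1/\rho}|b_n|^{1/n}$), the entire function $\overline{Q}_\nu$ has type $\sigma = 1$. -/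

import Mathlib

open Real Filter

/-- The logarithmic Stirling asymptotics `log (n!) / n - log n → -1`. -/
theorem tendsto_log_factorial_div_sub_log :
    Tendsto (fun n : ℕ => Real.log (Nat.factorial n : ℝ) / n - Real.log n) atTop (nhds (-1)) := by
  have hcast : Tendsto (fun n : ℕ => (n : ℝ)) atTop atTop := tendsto_natCast_atTop_atTop
  have hlog : Tendsto (fun n : ℕ => Real.log n / n) atTop (nhds 0) :=
    (Real.isLittleO_log_id_atTop.tendsto_div_nhds_zero).comp hcast
  have hstir : Tendsto (fun n : ℕ => Real.log (Stirling.stirlingSeq n) / n) atTop (nhds 0) :=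
    (Stirling.tendsto_stirlingSeq_sqrt_pi.log (by positivity)).div_atTop hcast
  have hconst : Tendsto (fun n : ℕ => Real.log 2 / n) atTop (nhds 0) :=
    tendsto_const_nhds.div_atTop hcast
  have key := ((hstir.add ((hconst.add hlog).const_mul (1 / 2))).sub_const 1)
  have hlim : (0 + 1 / 2 * (0 + 0) - 1 : ℝ) = -1 := by norm_num
  rw [hlim] at key
  refine key.congr' ?_
  filter_upwards [eventually_ge_atTop 1] with n hn
  have hn0 : (n : ℝ) ≠ 0 := by positivity
  rw [Stirling.log_stirlingSeq_formula, Real.log_mul two_ne_zero hn0,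
    Real.log_div hn0 (Real.exp_ne_zero 1), Real.log_exp]
  field_simp
  ring

/-- Shifting the argument of `Γ` by a constant at least `1` does not change the logarithmic
Stirling asymptotics. -/
theorem tendsto_log_Gamma_add_div_sub_log (a : ℝ) (ha : 1 ≤ a) :
    Tendsto (fun n : ℕ => Real.log (Real.Gamma (a + n)) / n - Real.log n) atTop (nhds (-1)) := by
  obtain ⟨m, hm⟩ := exists_nat_ge a
  have hcast : Tendsto (fun n : ℕ => (n : ℝ)) atTop atTop := tendsto_natCast_atTop_atTop
  have hlog : Tendsto (fun n : ℕ => Real.log n / n) atTop (nhds 0) :=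
    (Real.isLittleO_log_id_atTop.tendsto_div_nhds_zero).comp hcast
  have hconst : Tendsto (fun n : ℕ => Real.log 2 / n) atTop (nhds 0) :=
    tendsto_const_nhds.div_atTop hcast
  have hupper := tendsto_log_factorial_div_sub_log.add ((hconst.add hlog).const_mul (m : ℝ))
  have hlim : (-1 + (m : ℝ) * (0 + 0)) = -1 := by ring
  rw [hlim] at hupper
  refine tendsto_of_tendsto_of_tendsto_of_le_of_le' tendsto_log_factorial_div_sub_log hupper ?_ ?_
  · filter_upwards [eventually_ge_atTop 1] with n hn
    have hn1 : (1 : ℝ) ≤ n := by exact_mod_cast hn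
    have hle : (Nat.factorial n : ℝ) ≤ Real.Gamma (a + n) := by
      rw [← Real.Gamma_nat_eq_factorial]
      exact Real.Gamma_strictMonoOn_Ici.monotoneOn (by simp only [Set.mem_Ici]; linarith)
        (by simp only [Set.mem_Ici]; linarith) (by linarith)
    gcongr
  · filter_upwards [eventually_ge_atTop 1, eventually_ge_atTop m] with n hn hmn
    have hn1 : (1 : ℝ) ≤ n := by exact_mod_cast hn
    have hmn' : (m : ℝ) ≤ n := by exact_mod_cast hmn
    have hpos : 0 < Real.Gamma (a + n) := Real.Gamma_pos_of_pos (by linarith)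
    have hle : Real.Gamma (a + n) ≤ (Nat.factorial n : ℝ) * (2 * n) ^ m := by
      calc Real.Gamma (a + n) ≤ Real.Gamma ((n + m : ℕ) + 1) := by
            refine Real.Gamma_strictMonoOn_Ici.monotoneOn ?_ ?_ ?_
            all_goals try simp only [Set.mem_Ici, Nat.cast_add]
            all_goals linarith
        _ = ((n + m).factorial : ℝ) := Real.Gamma_nat_eq_factorial _
        _ = (n.factorial : ℝ) * ((n + 1).ascFactorial m : ℝ) := by
            rw [← Nat.factorial_mul_ascFactorial]; push_cast; ring
        _ ≤ (n.factorial : ℝ) * ((n + m : ℕ) : ℝ) ^ m := by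
            gcongr
            exact_mod_cast Nat.ascFactorial_le_pow_add n m
        _ ≤ (n.factorial : ℝ) * (2 * n) ^ m := by
            gcongr
            push_cast
            linarith
    have hlogle := Real.log_le_log hpos hle
    rw [Real.log_mul (by positivity) (by positivity), Real.log_pow,
      Real.log_mul two_ne_zero (by positivity)] at hlogle
    have hdiv := div_le_div_of_nonneg_right hlogle (by linarith : (0 : ℝ) ≤ n)
    have hsplit : (Real.log n.factorial + m * (Real.log 2 + Real.log n)) / n
        = Real.log n.factorial / n + m * (Real.log 2 / n + Real.log n / n) := by ring
    linarith

/-- For `ν > -1`, with `b_0 = 0` and `b_n = 1/((n-1)! Γ(ν+n+2) 4^n)` for `n ≥ 1`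
(the Taylor coefficients of `Q̄_ν(z) = ∑_{k≥0} (z/4)^{k+1}/(k! Γ(ν+k+3))`),
`limsup_{n→∞} n² |b_n|^{1/n} = e²/4`; i.e. `Q̄_ν` (of order `ρ = 1/2`) has type `σ = 1`. -/
theorem stmt_7 (ν : ℝ) (hν : -1 < ν)
    (b : ℕ → ℝ) (hb0 : b 0 = 0)
    (hb : ∀ n : ℕ, 1 ≤ n →
      b n = 1 / ((Nat.factorial (n - 1) : ℝ) * Real.Gamma (ν + n + 2) * 4 ^ n)) :
    Filter.limsup (fun n : ℕ => (n : ℝ) ^ 2 * |b n| ^ (1 / (n : ℝ))) atTop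
      = Real.exp 2 / 4 := by
  apply Tendsto.limsup_eq
  have hlog : Tendsto (fun n : ℕ => Real.log n / n) atTop (nhds 0) :=
    (Real.isLittleO_log_id_atTop.tendsto_div_nhds_zero).comp tendsto_natCast_atTop_atTop
  have key := (((hlog.sub tendsto_log_factorial_div_sub_log).sub
    (tendsto_log_Gamma_add_div_sub_log (ν + 2) (by linarith))).sub_const (Real.log 4)).rexp
  have hlim : Real.exp (0 - -1 - -1 - Real.log 4) = Real.exp 2 / 4 := by
    rw [Real.exp_sub, Real.exp_log (by norm_num)]
    norm_num
  rw [hlim] at key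
  refine key.congr' ?_
  filter_upwards [eventually_ge_atTop 1] with n hn
  have hn0 : (0 : ℝ) < n := by exact_mod_cast hn
  have hG : 0 < Real.Gamma (ν + n + 2) := Real.Gamma_pos_of_pos (by linarith)
  have hbpos : 0 < b n := by rw [hb n hn]; positivity
  have hfact : Real.log n.factorial = Real.log n + Real.log (n - 1).factorial := by
    rw [← Nat.mul_factorial_pred (by omega : n ≠ 0), Nat.cast_mul,
      Real.log_mul (by positivity) (by positivity)]
  have hlogb : Real.log (b n) = -(Real.log (n - 1).factorial
      + Real.log (Real.Gamma (ν + n + 2)) + n * Real.log 4) := by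
    rw [hb n hn, one_div, Real.log_inv, Real.log_mul (by positivity) (by positivity),
      Real.log_mul (by positivity) hG.ne', Real.log_pow]
  rw [abs_of_pos hbpos, ← Real.exp_log (by positivity : 0 < (n : ℝ) ^ 2 * b n ^ (1 / (n : ℝ))),
    Real.log_mul (by positivity) (by positivity), Real.log_rpow hbpos, Real.log_pow, hlogb, hfact,
    show ν + 2 + (n : ℝ) = ν + n + 2 by ring]
  congr 1
  field_simp
  push_cast
  ring
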